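/- Let m be odd and let e₀, e₁, f₁, …, e_m, f_m ∈ V satisfy q(e₀) ≠ 0, q(e_i) = q(f_i) = 0, B(e_i, f_j) = δ_{ij}, B(e_i, e_j) = 0 = B(f_i, f_j), and B(e₀, e_i) = 0 = B(e₀, f_i) for all i, j ≥ 1. Let λ₀, λ₁, …, λ_m ∈ F be nonzero and set t = λ₀ · ∏_{i=1}^m ι(e_i+f_i)·ι(e_i+λ_i f_i) in C(V,q). Then there exists s ∈ Γ(V,q) lying in the even part C₀(V,q) with reverse(s)·s = 1, s² = (−1)^{m(m+1)/2}, and s·t = reverse(t)·s (that is, s conjugates t to N(t)·t⁻¹ and N(s) = 1). -/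

import Mathlib

open CliffordAlgebra
section aux
variable {F V : Type*} [Field F] [AddCommGroup V] [Module F V] {Q : QuadraticForm F V}

theorem aux_lip (L : List V) (h : ∀ v ∈ L, Q v ≠ 0) :
    ∃ s : (CliffordAlgebra Q)ˣ, s ∈ lipschitzGroup Q ∧ (s : CliffordAlgebra Q) = (L.map (ι Q)).prod := by
  induction L with
  | nil => exact ⟨1, one_mem _, by simp⟩
  | cons a L ih =>
    obtain ⟨s, hs, hs'⟩ := ih fun v hv => h v (by simp [hv])
    have ha : Q a ≠ 0 := h a (by simp)
    have hu : IsUnit (ι Q a) := isUnit_ι_of_isUnit Q ha.isUnit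
    refine ⟨hu.unit * s, mul_mem (Subgroup.subset_closure ⟨a, by simp⟩) hs, by simp [hs']⟩

theorem aux_norm (L : List V) :
    reverse (L.map (ι Q)).prod * (L.map (ι Q)).prod = algebraMap F _ (L.map Q).prod := by
  induction L with
  | nil => simp
  | cons a L ih =>
    simp only [List.map_cons, List.prod_cons, reverse.map_mul, reverse_ι, map_mul]
    rw [← ih, mul_assoc, ← mul_assoc (ι Q a), ι_sq_scalar, ← mul_assoc, ← Algebra.commutes, mul_assoc]

theorem aux_swap (a : V) (L : List V) (h : ∀ v ∈ L, QuadraticMap.polar Q a v = 0) :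
    (L.map (ι Q)).prod * ι Q a = (-1) ^ L.length * (ι Q a * (L.map (ι Q)).prod) := by
  induction L with
  | nil => simp
  | cons b L ih =>
    have h1 : ι Q b * ι Q a = - (ι Q a * ι Q b) := by
      have := ι_mul_ι_add_swap (Q := Q) a b
      rw [h b (by simp), map_zero] at this
      exact eq_neg_of_add_eq_zero_right this
    simp only [List.map_cons, List.prod_cons, List.length_cons]
    rw [mul_assoc, ih fun v hv => h v (by simp [hv])]
    have hc : Commute (ι Q b) ((-1) ^ L.length) := (Commute.neg_one_right _).pow_right _
    rw [← mul_assoc, hc.eq, mul_assoc, ← mul_assoc (ι Q b), h1, pow_succ]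
    simp [mul_assoc]

theorem aux_rev (L : List V) (h : L.Pairwise fun a b => QuadraticMap.polar Q a b = 0) :
    reverse (L.map (ι Q)).prod = (-1) ^ (L.length * (L.length - 1) / 2) * (L.map (ι Q)).prod := by
  induction L with
  | nil => simp
  | cons a L ih =>
    rw [List.pairwise_cons] at h
    simp only [List.map_cons, List.prod_cons, List.length_cons, reverse.map_mul, reverse_ι]
    rw [ih h.2, mul_assoc, aux_swap a L h.1, ← mul_assoc, ← pow_add]
    congr 2
    have := Nat.triangle_succ L.length
    simp only [Nat.add_sub_cancel] at this ⊢
    omega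

theorem aux_comm {a b c : V} (h1 : QuadraticMap.polar Q a b = 0) (h2 : QuadraticMap.polar Q a c = 0) :
    Commute (ι Q a) (ι Q b * ι Q c) := by
  have k1 := ι_mul_ι_add_swap (Q := Q) a b
  have k2 := ι_mul_ι_add_swap (Q := Q) a c
  rw [h1, map_zero] at k1
  rw [h2, map_zero] at k2
  rw [commute_iff_eq, ← mul_assoc, eq_neg_of_add_eq_zero_left k1, neg_mul, mul_assoc,
    eq_neg_of_add_eq_zero_left k2, mul_neg, neg_neg, mul_assoc]

theorem aux_conj {A I : Type*} [Ring A] (w p p' : I → A)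
    (h1 : ∀ i, w i * p i = p' i * w i)
    (h2 : ∀ i j, i ≠ j → Commute (w i) (p j))
    (h3 : ∀ i j, i ≠ j → Commute (w i) (p' j))
    (L : List I) (hL : L.Nodup) :
    (L.map w).prod * (L.map p).prod = (L.map p').prod * (L.map w).prod := by
  induction L with
  | nil => simp
  | cons i L ih =>
    rw [List.nodup_cons] at hL
    simp only [List.map_cons, List.prod_cons]
    have c1 : Commute (p i) (L.map w).prod := by
      apply Commute.list_prod_right
      intro x hx
      obtain ⟨j, hj, rfl⟩ := List.mem_map.1 hx
      exact (h2 j i (by rintro rfl; exact hL.1 hj)).symm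
    have c2 : Commute (w i) (L.map p').prod := by
      apply Commute.list_prod_right
      intro x hx
      obtain ⟨j, hj, rfl⟩ := List.mem_map.1 hx
      exact h3 i j (by rintro rfl; exact hL.1 hj)
    rw [mul_assoc, ← mul_assoc _ (p i), ← c1.eq, mul_assoc, ih hL.2, ← mul_assoc, h1,
      mul_assoc, ← mul_assoc (w i), c2.eq]
    simp only [mul_assoc]

theorem aux_revp {I : Type*} (p p' : I → CliffordAlgebra Q)
    (h1 : ∀ i, reverse (p i) = p' i)
    (h2 : ∀ i j, i ≠ j → Commute (p' i) (p' j))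
    (L : List I) (hL : L.Nodup) :
    reverse (L.map p).prod = (L.map p').prod := by
  induction L with
  | nil => simp
  | cons i L ih =>
    rw [List.nodup_cons] at hL
    simp only [List.map_cons, List.prod_cons, reverse.map_mul]
    rw [ih hL.2, h1]
    refine (Commute.list_prod_right _ _ ?_).symm.eq
    intro x hx
    obtain ⟨j, hj, rfl⟩ := List.mem_map.1 hx
    exact h2 i j (by rintro rfl; exact hL.1 hj)

theorem aux_even (L : List V) :
    (L.map (ι Q)).prod ∈ evenOdd Q (L.length : ZMod 2) := by
  induction L with
  | nil => simpa using one_le_evenOdd_zero Q (Submodule.mem_one.2 ⟨1, by simp⟩)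
  | cons a L ih =>
    simp only [List.map_cons, List.prod_cons, List.length_cons, Nat.cast_add, Nat.cast_one]
    rw [add_comm]
    exact SetLike.mul_mem_graded (ι_mem_evenOdd_one Q a) ih

end aux

theorem stmt13 {F V : Type*} [Field F] [AddCommGroup V] [Module F V] [FiniteDimensional F V]
    (hF2 : (2 : F) ≠ 0) (Q : QuadraticForm F V)
    (m : ℕ) (hm : Odd m) (e₀ : V) (e f : Fin m → V)
    (he₀ : Q e₀ ≠ 0)
    (he : ∀ i, Q (e i) = 0) (hf : ∀ i, Q (f i) = 0)
    (hef : ∀ i j, QuadraticMap.polar Q (e i) (f j) = if i = j then 1 else 0)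
    (hee : ∀ i j, QuadraticMap.polar Q (e i) (e j) = 0)
    (hff : ∀ i j, QuadraticMap.polar Q (f i) (f j) = 0)
    (he₀e : ∀ i, QuadraticMap.polar Q e₀ (e i) = 0)
    (he₀f : ∀ i, QuadraticMap.polar Q e₀ (f i) = 0)
    (l₀ : F) (hl₀ : l₀ ≠ 0) (l : Fin m → F) (hl : ∀ i, l i ≠ 0)
    (t : CliffordAlgebra Q)
    (ht : t = l₀ • (List.ofFn fun i => ι Q (e i + f i) * ι Q (e i + l i • f i)).prod) :
    ∃ s : (CliffordAlgebra Q)ˣ, s ∈ lipschitzGroup Q ∧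
      (s : CliffordAlgebra Q) ∈ evenOdd Q 0 ∧
      reverse (s : CliffordAlgebra Q) * (s : CliffordAlgebra Q) = 1 ∧
      (s : CliffordAlgebra Q) ^ 2 = (-1 : CliffordAlgebra Q) ^ (m * (m + 1) / 2) ∧
      (s : CliffordAlgebra Q) * t = reverse t * s := by
  have hm0 : 0 < m := hm.pos
  let i0 : Fin m := ⟨0, hm0⟩
  let μ : Fin m → F := fun i => if i = i0 then (Q e₀)⁻¹ else 1
  have hμ : ∀ i, μ i ≠ 0 := by
    intro i; simp only [μ]; split_ifs <;> simp [he₀]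
  have hμp : ∏ i, μ i = (Q e₀)⁻¹ := by simp [μ, Finset.prod_ite_eq']
  let x : F → Fin m → V := fun c i => e i + c • f i
  have hfe : ∀ i j, QuadraticMap.polar Q (f i) (e j) = if i = j then 1 else 0 := by
    intro i j; rw [QuadraticMap.polar_comm, hef]; simp [eq_comm]
  have hQx : ∀ c i, Q (x c i) = c := by
    intro c i
    have : QuadraticMap.polar Q (e i) (c • f i) = c := by simp [QuadraticMap.polar_smul_right, hef]
    rw [QuadraticMap.polar, QuadraticMap.map_smul, he, hf] at this
    simpa using this
  have hpx : ∀ c d i j, i ≠ j → QuadraticMap.polar Q (x c i) (x d j) = 0 := by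
    intro c d i j hij
    simp [x, QuadraticMap.polar_add_left, QuadraticMap.polar_add_right,
      QuadraticMap.polar_smul_left, QuadraticMap.polar_smul_right, hef, hfe, hee, hff, hij]
  have hp0 : ∀ c i, QuadraticMap.polar Q e₀ (x c i) = 0 := by
    intro c i
    simp [x, QuadraticMap.polar_add_right, QuadraticMap.polar_smul_right, he₀e, he₀f]
  let w : Fin m → CliffordAlgebra Q := fun i => ι Q (x (μ i) i)
  let p : Fin m → CliffordAlgebra Q := fun i => ι Q (x 1 i) * ι Q (x (l i) i)
  let p' : Fin m → CliffordAlgebra Q := fun i => ι Q (x (l i) i) * ι Q (x 1 i)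
  have ht' : t = l₀ • ((List.finRange m).map p).prod := by
    rw [ht, List.ofFn_eq_map]; simp [p, x]
  let L : List V := e₀ :: (List.finRange m).map fun i => x (μ i) i
  have hlen : L.length = m + 1 := by simp [L]
  have hpw : L.Pairwise fun a b => QuadraticMap.polar Q a b = 0 := by
    simp only [L, List.pairwise_cons, List.pairwise_map]
    refine ⟨by simp [hp0], ?_⟩
    exact (List.nodup_finRange m).imp fun {a b} hab => hpx _ _ _ _ hab
  have hprod : (L.map Q).prod = 1 := by
    have : ((List.finRange m).map μ).prod = ∏ i, μ i := by
      rw [← List.ofFn_eq_map, List.prod_ofFn]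
    simp [L, Function.comp_def, hQx, this, hμp, he₀]
  obtain ⟨s, hs, hs'⟩ := aux_lip (Q := Q) L (by simp [L, hQx, he₀, hμ])
  have hN : reverse (s : CliffordAlgebra Q) * (s : CliffordAlgebra Q) = 1 := by
    rw [hs', aux_norm, hprod, map_one]
  refine ⟨s, hs, ?_, hN, ?_, ?_⟩
  · rw [hs']
    have := aux_even (Q := Q) L
    rwa [hlen, (ZMod.natCast_eq_zero_iff_even).2 hm.add_one] at this
  · have hr := aux_rev L hpw
    rw [← hs', hlen, Nat.add_sub_cancel, mul_comm (m + 1)] at hr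
    rw [hr] at hN
    have h1 : ((-1 : CliffordAlgebra Q) ^ (m * (m + 1) / 2)) * (-1) ^ (m * (m + 1) / 2) = 1 := by
      rw [← pow_add]; exact Even.neg_one_pow ⟨_, rfl⟩
    calc (s : CliffordAlgebra Q) ^ 2 = ((-1 : CliffordAlgebra Q) ^ (m * (m + 1) / 2)) * (((-1) ^ (m * (m + 1) / 2)) * s * s) := by
          rw [mul_assoc, ← mul_assoc, h1, one_mul, pow_two]
      _ = _ := by rw [hN, mul_one]
  · have hsw : (s : CliffordAlgebra Q) = ι Q e₀ * ((List.finRange m).map w).prod := by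
      rw [hs']; simp [L, w, Function.comp_def]
    have hrt : reverse ((List.finRange m).map p).prod = ((List.finRange m).map p').prod := by
      apply aux_revp _ _ _ _ _ (List.nodup_finRange m)
      · intro i; simp only [p, p', reverse.map_mul, reverse_ι]
      · intro i j hij
        exact Commute.mul_left (aux_comm (hpx _ _ _ _ hij) (hpx _ _ _ _ hij))
          (aux_comm (hpx _ _ _ _ hij) (hpx _ _ _ _ hij))
    have hc0 : Commute (ι Q e₀) ((List.finRange m).map p').prod := by
      apply Commute.list_prod_right
      intro y hy
      obtain ⟨j, hj, rfl⟩ := List.mem_map.1 hy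
      exact aux_comm (hp0 _ _) (hp0 _ _)
    have hcj := aux_conj w p p' ?_ ?_ ?_ _ (List.nodup_finRange m)
    · rw [ht', map_smul, hrt, mul_smul_comm, smul_mul_assoc, hsw, mul_assoc, hcj, ← mul_assoc,
        hc0.eq, mul_assoc]
    · intro i
      have key : ∀ c : F, ι Q (x c i) = ι Q (e i) + c • ι Q (f i) := by
        intro c; simp [x]
      have k1 : ι Q (e i) * ι Q (e i) = 0 := by rw [ι_sq_scalar, he, map_zero]
      have k2 : ι Q (f i) * ι Q (f i) = 0 := by rw [ι_sq_scalar, hf, map_zero]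
      simp only [w, p, p', key]
      simp only [mul_add, add_mul, smul_mul_assoc, mul_smul_comm, one_smul, mul_assoc, k1, k2,
        mul_zero, smul_zero]
      simp only [← mul_assoc, k1, k2, zero_mul, smul_zero, add_zero, zero_add]
      module
    · intro i j hij
      exact aux_comm (hpx _ _ _ _ hij) (hpx _ _ _ _ hij)
    · intro i j hij
      exact aux_comm (hpx _ _ _ _ hij) (hpx _ _ _ _ hij)
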